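/- Let (X,d) be a metric space, E : X → ℝ, k > 0, M, N ≥ 1, and let γ_{i,j} ∈ ℝ be given for i = 1,…,N, j = −M+1,…,i−1, with the conventions γ_{0,j} = γ_{N+1,j} = 0. Define w_{i,j} = γ_{i+1,j} − γ_{i,j} for i > j and w_{i,j} = 0 for i ≤ j (for i = 0,…,N and j = −M+1,…,N). Suppose v_{−M+1},…,v_N ∈ X satisfy, for each i = 1,…,N, E(v_i) + (1/(2k)) Σ_{j=−M+1}^{i−1} γ_{i,j} d(v_i,v_j)² ≤ E(v_{i−1}) + (1/(2k)) Σ_{j=−M+1}^{i−2} γ_{i,j} d(v_{i−1},v_j)². Suppose further there exist m ∈ ℕ, a finite index set A, and for each α ∈ A coefficients θ^α_{i,j} ∈ ℝ (indices i = 0,…,N, j = −M+1,…,N) such that: Σ_{α∈A} θ^α_{i,j} = w_{i,j} for all i,j; for each α there exist points p^α_{−M+1},…,p^α_N ∈ ℝᵐ with ‖p^α_i − p^α_j‖ = d(v_i,v_j) whenever θ^α_{i,j} ≠ 0; and each matrix Q^α = Σ_{i,j} θ^α_{i,j} (e_{i+M} − e_{j+M}) ⊗ (e_{i+M} − e_{j+M})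 ∈ ℝ^{(M+N)×(M+N)} is negative semidefinite. Then E(v_N) ≤ E(v_0), i.e., the scheme is energy stable. -/

import Mathlib

open Matrix

theorem Finset.sum_Icc_zero_natCast {R : Type*} [AddCommMonoid R] (f : ℤ → R) (n : ℕ) :
    ∑ i ∈ Finset.Icc (0 : ℤ) (n : ℤ), f i = ∑ i ∈ Finset.range (n + 1), f (i : ℤ) := by
  refine Finset.sum_bij' (fun i _ => i.toNat) (fun i _ => (i : ℤ)) ?_ ?_ ?_ ?_ ?_
  · intro i hi
    simp only [Finset.mem_Icc, Finset.mem_range] at hi ⊢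
    omega
  · intro i hi
    simp only [Finset.mem_Icc, Finset.mem_range] at hi ⊢
    omega
  · intro i hi
    exact Int.toNat_of_nonneg (Finset.mem_Icc.mp hi).1
  · intro i hi
    exact Int.toNat_natCast i
  · intro i hi
    rw [Int.toNat_of_nonneg (Finset.mem_Icc.mp hi).1]

theorem Finset.sum_Icc_ite_lt {R : Type*} [AddCommMonoid R] (f : ℤ → R) {a i b : ℤ}
    (hib : i ≤ b) :
    ∑ j ∈ Finset.Icc a b, (if j < i then f j else 0) = ∑ j ∈ Finset.Icc a (i - 1), f j := by
  rw [← Finset.sum_filter]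
  refine Finset.sum_congr ?_ fun _ _ => rfl
  ext j
  simp only [Finset.mem_filter, Finset.mem_Icc]
  omega

/-- Telescoping of `E i + c * T i ≤ E (i - 1) + c * S (i - 1)`. -/
theorem le_add_mul_sum_sub_of_step {E S T : ℕ → ℝ} {c : ℝ} {N : ℕ} (hT : T 0 = 0)
    (hstep : ∀ n < N, E (n + 1) + c * T (n + 1) ≤ E n + c * S n) (hS : S N = 0) :
    E N ≤ E 0 + c * ∑ i ∈ Finset.range (N + 1), (S i - T i) := by
  have key : ∀ n ≤ N, E n ≤ E 0 + c * (∑ i ∈ Finset.range (n + 1), (S i - T i) - S n) := by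
    intro n
    induction n with
    | zero => simp [hT]
    | succ n ih =>
      intro hn
      have h1 := ih (by omega)
      have h2 := hstep n (by omega)
      rw [Finset.sum_range_succ]
      linarith
  simpa [hS] using key N le_rfl

theorem Matrix.dotProduct_vecMulVec_self_mulVec {n : Type*} [Fintype n] (x a : n → ℝ) :
    x ⬝ᵥ (Matrix.vecMulVec a a).mulVec x = (x ⬝ᵥ a) ^ 2 := by
  rw [Matrix.vecMulVec_mulVec, dotProduct_comm a x]
  simp [dotProduct_smul, pow_two]

/-- A graph Laplacian form that is nonpositive on real vectors is nonpositive on vectors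
of points of a Euclidean space. -/
theorem sum_mul_norm_sub_sq_nonpos {ι κ : Type*} [Fintype κ] {m : ℕ} (s t : Finset ι)
    (θ : ι → ι → ℝ) (e : ι → κ → ℝ) (p : ι → EuclideanSpace ℝ (Fin m))
    (y : Fin m → κ → ℝ)
    (hys : ∀ c, ∀ i ∈ s, y c ⬝ᵥ e i = p i c) (hyt : ∀ c, ∀ i ∈ t, y c ⬝ᵥ e i = p i c)
    (hQ : ∀ x : κ → ℝ, x ⬝ᵥ (∑ i ∈ s, ∑ j ∈ t,
      θ i j • Matrix.vecMulVec (e i - e j) (e i - e j)).mulVec x ≤ 0) :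
    ∑ i ∈ s, ∑ j ∈ t, θ i j * ‖p i - p j‖ ^ 2 ≤ 0 := by
  have hform : ∀ c, y c ⬝ᵥ (∑ i ∈ s, ∑ j ∈ t,
      θ i j • Matrix.vecMulVec (e i - e j) (e i - e j)).mulVec (y c)
      = ∑ i ∈ s, ∑ j ∈ t, θ i j * (p i c - p j c) ^ 2 := by
    intro c
    simp only [Matrix.sum_mulVec, dotProduct_sum, Matrix.smul_mulVec, dotProduct_smul,
      Matrix.dotProduct_vecMulVec_self_mulVec, smul_eq_mul, dotProduct_sub]
    refine Finset.sum_congr rfl fun i hi => Finset.sum_congr rfl fun j hj => ?_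
    rw [hys c i hi, hyt c j hj]
  have hsum : ∑ i ∈ s, ∑ j ∈ t, θ i j * ‖p i - p j‖ ^ 2
      = ∑ c, ∑ i ∈ s, ∑ j ∈ t, θ i j * (p i c - p j c) ^ 2 := by
    symm
    rw [Finset.sum_comm]
    refine Finset.sum_congr rfl fun i _ => ?_
    rw [Finset.sum_comm]
    refine Finset.sum_congr rfl fun j _ => ?_
    simp [EuclideanSpace.norm_sq_eq, Finset.mul_sum]
  rw [hsum]
  exact Finset.sum_nonpos fun c _ => hform c ▸ hQ (y c)

/-- Claim 1: unconditional energy stability of the M-step N-stage mixed variational scheme.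
Here, for `i ∈ {-M+1, …, N}`, the (1-based) basis vector `e_{i+M}` of `ℝ^{M+N}` is the
indicator of the (0-based) index `i + M - 1` in `Fin (M+N)`. -/
theorem energy_stability_of_graph_decomposition
    {X : Type*} [MetricSpace X] (E : X → ℝ) (k : ℝ) (hk : 0 < k)
    (M N : ℕ) (hM : 1 ≤ M) (hN : 1 ≤ N)
    (γ : ℤ → ℤ → ℝ) (hγ0 : ∀ j : ℤ, γ 0 j = 0) (hγN : ∀ j : ℤ, γ ((N : ℤ) + 1) j = 0)
    (w : ℤ → ℤ → ℝ)
    (hw : ∀ i j : ℤ, w i j = if j < i then γ (i + 1) j - γ i j else 0)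
    (v : ℤ → X)
    (hmin : ∀ i ∈ Finset.Icc (1 : ℤ) (N : ℤ),
      E (v i) + (1 / (2 * k)) *
          ∑ j ∈ Finset.Icc (-(M : ℤ) + 1) (i - 1), γ i j * dist (v i) (v j) ^ 2
        ≤ E (v (i - 1)) + (1 / (2 * k)) *
          ∑ j ∈ Finset.Icc (-(M : ℤ) + 1) (i - 2), γ i j * dist (v (i - 1)) (v j) ^ 2)
    (m : ℕ) {A : Type*} [Fintype A] (θ : A → ℤ → ℤ → ℝ)
    (hθw : ∀ i ∈ Finset.Icc (0 : ℤ) (N : ℤ), ∀ j ∈ Finset.Icc (-(M : ℤ) + 1) (N : ℤ),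
      ∑ α : A, θ α i j = w i j)
    (e : ℤ → Fin (M + N) → ℝ)
    (he : ∀ i : ℤ, ∀ l : Fin (M + N), e i l = if (l : ℤ) = i + (M : ℤ) - 1 then 1 else 0)
    (hembed : ∀ α : A, ∃ p : ℤ → EuclideanSpace ℝ (Fin m),
      ∀ i ∈ Finset.Icc (0 : ℤ) (N : ℤ), ∀ j ∈ Finset.Icc (-(M : ℤ) + 1) (N : ℤ),
        θ α i j ≠ 0 → ‖p i - p j‖ = dist (v i) (v j))
    (hNSD : ∀ α : A, ∀ x : Fin (M + N) → ℝ,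
      x ⬝ᵥ (∑ i ∈ Finset.Icc (0 : ℤ) (N : ℤ), ∑ j ∈ Finset.Icc (-(M : ℤ) + 1) (N : ℤ),
        θ α i j • Matrix.vecMulVec (e i - e j) (e i - e j)).mulVec x ≤ 0) :
    E (v (N : ℤ)) ≤ E (v 0) := by
  have hc : 0 ≤ 1 / (2 * k) := by positivity
  have hpart : ∀ α : A, ∑ i ∈ Finset.Icc (0 : ℤ) (N : ℤ),
      ∑ j ∈ Finset.Icc (-(M : ℤ) + 1) (N : ℤ), θ α i j * dist (v i) (v j) ^ 2 ≤ 0 := by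
    intro α
    obtain ⟨p, hp⟩ := hembed α
    have hy : ∀ c, ∀ i ∈ Finset.Icc (-(M : ℤ) + 1) (N : ℤ),
        (fun l : Fin (M + N) => p ((l : ℤ) - M + 1) c) ⬝ᵥ e i = p i c := by
      intro c i hi
      rw [Finset.mem_Icc] at hi
      have hl : (i + M - 1).toNat < M + N := by omega
      rw [dotProduct, Finset.sum_eq_single ⟨(i + M - 1).toNat, hl⟩]
      · have h : (((i + M - 1).toNat : ℕ) : ℤ) = i + M - 1 := Int.toNat_of_nonneg (by omega)
        rw [he]
        simp only [h, if_true, mul_one]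
        rw [show i + (M : ℤ) - 1 - M + 1 = i by ring]
      · intro l _ hne
        rw [he, if_neg, mul_zero]
        intro h
        exact hne (Fin.ext (by simp only; omega))
      · simp
    have hneg := sum_mul_norm_sub_sq_nonpos (Finset.Icc (0 : ℤ) (N : ℤ))
      (Finset.Icc (-(M : ℤ) + 1) (N : ℤ)) (θ α) e p _
      (fun c i hi => hy c i (Finset.Icc_subset_Icc_left (by omega) hi)) hy (hNSD α)
    refine le_of_eq_of_le ?_ hneg
    refine Finset.sum_congr rfl fun i hi => Finset.sum_congr rfl fun j hj => ?_
    by_cases h : θ α i j = 0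
    · simp [h]
    · rw [hp i hi j hj h]
  have hW : ∑ i ∈ Finset.Icc (0 : ℤ) (N : ℤ), ∑ j ∈ Finset.Icc (-(M : ℤ) + 1) (N : ℤ),
      w i j * dist (v i) (v j) ^ 2 ≤ 0 := by
    refine le_of_eq_of_le ?_ (Finset.sum_nonpos fun α (_ : α ∈ Finset.univ) => hpart α)
    symm
    rw [Finset.sum_comm]
    refine Finset.sum_congr rfl fun i hi => ?_
    rw [Finset.sum_comm]
    refine Finset.sum_congr rfl fun j hj => ?_
    rw [← hθw i hi j hj, Finset.sum_mul]
  have htel := le_add_mul_sum_sub_of_step (N := N) (c := 1 / (2 * k))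
    (E := fun n => E (v n))
    (S := fun n => ∑ j ∈ Finset.Icc (-(M : ℤ) + 1) ((n : ℤ) - 1),
      γ ((n : ℤ) + 1) j * dist (v n) (v j) ^ 2)
    (T := fun n => ∑ j ∈ Finset.Icc (-(M : ℤ) + 1) ((n : ℤ) - 1),
      γ n j * dist (v n) (v j) ^ 2)
    (by simp [hγ0])
    (by
      intro n hn
      have h := hmin ((n : ℤ) + 1) (Finset.mem_Icc.mpr ⟨by omega, by omega⟩)
      have h2 : (n : ℤ) + 1 - 2 = n - 1 := by ring
      rw [add_sub_cancel_right, h2] at h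
      simpa using h)
    (by simp [hγN])
  have hST : ∑ i ∈ Finset.Icc (0 : ℤ) (N : ℤ), ∑ j ∈ Finset.Icc (-(M : ℤ) + 1) (N : ℤ),
      w i j * dist (v i) (v j) ^ 2
      = ∑ i ∈ Finset.range (N + 1), (∑ j ∈ Finset.Icc (-(M : ℤ) + 1) ((i : ℤ) - 1),
          γ ((i : ℤ) + 1) j * dist (v i) (v j) ^ 2
        - ∑ j ∈ Finset.Icc (-(M : ℤ) + 1) ((i : ℤ) - 1), γ i j * dist (v i) (v j) ^ 2) := by
    rw [Finset.sum_Icc_zero_natCast]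
    refine Finset.sum_congr rfl fun i hi => ?_
    rw [Finset.mem_range] at hi
    simp only [hw, ite_mul, zero_mul]
    rw [Finset.sum_Icc_ite_lt _ (by omega), ← Finset.sum_sub_distrib]
    simp only [sub_mul]
  rw [← hST] at htel
  simpa using htel.trans (add_le_of_nonpos_right (mul_nonpos_of_nonneg_of_nonpos hc hW))
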